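/- arXiv:2206.04552 — 2 statements merged into one kernel-verified Lean document; each statement's English description precedes it below -/
import Mathlib

section
/- Exponential test functions characterise the measure equation (Proposition 5): assume ∫ ‖x‖² dQ(x) < ∞ and ∫ ‖C DU(x)‖² dQ(x) < ∞. Then ∫_X A f(x) dQ(x) = 0 for every f ∈ FC_b^∞(X) if and only if ∫_X A(e^{i⟨s,·⟩})(x) dQ(x) = 0 for every s ∈ X. -/
open MeasureTheory ProbabilityTheory Complex Filter
open scoped RealInnerProductSpace

/-- The (non-vectorised) Stein operator acting on real-valued functions:
`A f(x) = ∑ᵢ λᵢ D²f(x)[eᵢ,eᵢ] − ⟨Df(x), x + C DU(x)⟩`. -/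
noncomputable def steinAR {X : Type*} [NormedAddCommGroup X] [InnerProductSpace ℝ X]
    (C : X →L[ℝ] X) (DU : X → X) (e : ℕ → X) (l : ℕ → ℝ) (f : X → ℝ) (x : X) : ℝ :=
  (∑' i, l i * fderiv ℝ (fun x1 => fderiv ℝ f x1 (e i)) x (e i))
    - fderiv ℝ f x (x + C (DU x))

/-- The (non-vectorised) Stein operator acting on complex-valued functions. -/
noncomputable def steinA {X : Type*} [NormedAddCommGroup X] [InnerProductSpace ℝ X]
    (C : X →L[ℝ] X) (DU : X → X) (e : ℕ → X) (l : ℕ → ℝ) (f : X → ℂ) (x : X) : ℂ :=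
  (∑' i, (l i : ℂ) * fderiv ℝ (fun x1 => fderiv ℝ f x1 (e i)) x (e i))
    - fderiv ℝ f x (x + C (DU x))

/-- `f` is a cylindrical function in `FC_b^∞(X)`: `f(x) = φ(⟪l₁,x⟫, …, ⟪l_n,x⟫)` with
`φ` infinitely differentiable with bounded derivatives of all orders. -/
def IsCylindricalCb {X : Type*} [NormedAddCommGroup X] [InnerProductSpace ℝ X]
    (f : X → ℝ) : Prop :=
  ∃ (n : ℕ) (L : Fin n → X) (φ : (Fin n → ℝ) → ℝ),
    ContDiff ℝ (⊤ : ℕ∞) φ ∧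
    (∀ m : ℕ, ∃ B : ℝ, ∀ z : Fin n → ℝ, ‖iteratedFDeriv ℝ m φ z‖ ≤ B) ∧
    f = fun x => φ (fun j => ⟪L j, x⟫)


section helpers
variable {X : Type*} [NormedAddCommGroup X] [InnerProductSpace ℝ X]

lemma aux_hasSum_congr {M : Type*} [AddCommMonoid M] [TopologicalSpace M] {f g : ℕ → M} {a : M}
    (h : HasSum f a) (hfg : ∀ i, g i = f i) : HasSum g a := by
  rwa [show g = f from funext hfg]

lemma aux_hasFDerivAt_inner {F : Type*} [NormedAddCommGroup F] [NormedSpace ℝ F]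
    (s : X) (h h' : ℝ → F) (hh : ∀ t, HasDerivAt h (h' t) t) (x : X) :
    HasFDerivAt (fun y : X => h ⟪s, y⟫) ((innerSL ℝ s).smulRight (h' ⟪s, x⟫)) x := by
  have h1 : HasFDerivAt (fun y : X => ⟪s, y⟫) (innerSL ℝ s) x := (innerSL ℝ s).hasFDerivAt
  have h2 := (hh ⟪s, x⟫).hasFDerivAt.comp x h1
  have h3 : (innerSL ℝ s).smulRight (h' ⟪s, x⟫)
      = (ContinuousLinearMap.toSpanSingleton ℝ (h' ⟪s, x⟫)).comp (innerSL ℝ s) := by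
    ext v; simp
  rw [h3]
  exact h2

lemma aux_fderiv_inner {F : Type*} [NormedAddCommGroup F] [NormedSpace ℝ F]
    (s : X) (h h' : ℝ → F) (hh : ∀ t, HasDerivAt h (h' t) t) (x v : X) :
    fderiv ℝ (fun y : X => h ⟪s, y⟫) x v = ⟪s, v⟫ • h' ⟪s, x⟫ := by
  rw [(aux_hasFDerivAt_inner s h h' hh x).fderiv]
  simp

lemma aux_fderiv2_inner {F : Type*} [NormedAddCommGroup F] [NormedSpace ℝ F]
    (s : X) (h h' h'' : ℝ → F) (hh : ∀ t, HasDerivAt h (h' t) t)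
    (hh' : ∀ t, HasDerivAt h' (h'' t) t) (x v : X) :
    fderiv ℝ (fun z => fderiv ℝ (fun y : X => h ⟪s, y⟫) z v) x v
      = (⟪s, v⟫ ^ 2) • h'' ⟪s, x⟫ := by
  simp_rw [aux_fderiv_inner s h h' hh]
  have := aux_fderiv_inner s (fun t => ⟪s, v⟫ • h' t) (fun t => ⟪s, v⟫ • h'' t)
    (fun t => (hh' t).const_smul _) x v
  rw [this, smul_smul, sq]

lemma aux_hasSum [CompleteSpace X] (C : X →L[ℝ] X) (hCsa : IsSelfAdjoint C)
    (e : HilbertBasis ℕ ℝ X) (l : ℕ → ℝ)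
    (hCe : ∀ i, C (e i) = l i • e i) (s : X) :
    HasSum (fun i => l i * ⟪s, e i⟫ ^ 2) ⟪C s, s⟫ := by
  have h := e.hasSum_inner_mul_inner (C s) s
  refine aux_hasSum_congr h fun i => ?_
  have : ⟪C s, e i⟫ = ⟪s, C (e i)⟫ := by
    rw [← ContinuousLinearMap.adjoint_inner_right, hCsa.adjoint_eq]
  rw [this, hCe, inner_smul_right, real_inner_comm s (e i)]
  ring

lemma aux_steinA_exp [CompleteSpace X] (C : X →L[ℝ] X) (hCsa : IsSelfAdjoint C) (DU : X → X)
    (e : HilbertBasis ℕ ℝ X) (l : ℕ → ℝ)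
    (hCe : ∀ i, C (e i) = l i • e i) (s x : X) :
    steinA C DU (fun i => e i) l (fun y => Complex.exp ((⟪s, y⟫ : ℂ) * Complex.I)) x
      = (-(⟪C s, s⟫ : ℂ) - (⟪s, x + C (DU x)⟫ : ℂ) * Complex.I)
        * Complex.exp ((⟪s, x⟫ : ℂ) * Complex.I) := by
  have h1 : ∀ t : ℝ, HasDerivAt (fun t : ℝ => Complex.exp ((t : ℂ) * Complex.I))
      (Complex.exp ((t : ℂ) * Complex.I) * Complex.I) t := by
    intro t
    have := ((Complex.ofRealCLM.hasDerivAt (x := t)).mul_const Complex.I).cexp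
    simpa using this
  have h2 : ∀ t : ℝ, HasDerivAt (fun t : ℝ => Complex.exp ((t : ℂ) * Complex.I) * Complex.I)
      (-Complex.exp ((t : ℂ) * Complex.I)) t := by
    intro t
    have := (h1 t).mul_const Complex.I
    simpa [mul_assoc] using this
  unfold steinA
  simp_rw [aux_fderiv2_inner s _ _ _ h1 h2]
  rw [aux_fderiv_inner s _ _ h1]
  have h3 : HasSum (fun i => (l i : ℂ) * ((⟪s, e i⟫ ^ 2 : ℝ) •
      (-Complex.exp ((⟪s, x⟫ : ℂ) * Complex.I))))
      ((⟪C s, s⟫ : ℂ) * (-Complex.exp ((⟪s, x⟫ : ℂ) * Complex.I))) := by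
    have h := (Complex.hasSum_ofReal.mpr (aux_hasSum C hCsa e l hCe s)).mul_right
      (-Complex.exp ((⟪s, x⟫ : ℂ) * Complex.I))
    refine aux_hasSum_congr h fun i => ?_
    rw [Complex.real_smul]; push_cast; ring
  rw [h3.tsum_eq, Complex.real_smul]
  ring

lemma aux_steinAR_inner [CompleteSpace X] (C : X →L[ℝ] X) (hCsa : IsSelfAdjoint C) (DU : X → X)
    (e : HilbertBasis ℕ ℝ X) (l : ℕ → ℝ)
    (hCe : ∀ i, C (e i) = l i • e i) (s x : X) (h h' h'' : ℝ → ℝ)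
    (hh : ∀ t, HasDerivAt h (h' t) t)
    (hh' : ∀ t, HasDerivAt h' (h'' t) t) :
    steinAR C DU (fun i => e i) l (fun y => h ⟪s, y⟫) x
      = ⟪C s, s⟫ * h'' ⟪s, x⟫ - ⟪s, x + C (DU x)⟫ * h' ⟪s, x⟫ := by
  unfold steinAR
  simp_rw [aux_fderiv2_inner s _ _ _ hh hh']
  rw [aux_fderiv_inner s _ _ hh]
  have h3 := (aux_hasSum C hCsa e l hCe s).mul_right (h'' ⟪s, x⟫)
  simp only [smul_eq_mul, ← mul_assoc]
  rw [h3.tsum_eq]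

lemma aux_bound_comp_right {E G F : Type*} [NormedAddCommGroup E] [NormedSpace ℝ E]
    [NormedAddCommGroup F] [NormedSpace ℝ F] [NormedAddCommGroup G] [NormedSpace ℝ G]
    (T : G →L[ℝ] E) (φ : E → F) (hφ : ContDiff ℝ (⊤ : ℕ∞) φ)
    (hB : ∀ m : ℕ, ∃ B : ℝ, ∀ z, ‖iteratedFDeriv ℝ m φ z‖ ≤ B) :
    ∀ m : ℕ, ∃ B : ℝ, ∀ z, ‖iteratedFDeriv ℝ m (φ ∘ T) z‖ ≤ B := by
  intro m
  obtain ⟨B, hB⟩ := hB m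
  refine ⟨B * ‖T‖ ^ m, fun z => ?_⟩
  rw [T.iteratedFDeriv_comp_right hφ z (by exact_mod_cast le_top)]
  refine (ContinuousMultilinearMap.norm_compContinuousLinearMap_le _ _).trans ?_
  simp only [Finset.prod_const, Finset.card_univ, Fintype.card_fin]
  gcongr
  exact hB _

lemma aux_cyl (s : X) (h : ℝ → ℝ) (hc : ContDiff ℝ (⊤ : ℕ∞) h)
    (hb : ∀ (m : ℕ) t, |iteratedDeriv m h t| ≤ 1) :
    IsCylindricalCb (fun y => h ⟪s, y⟫) := by
  refine ⟨1, fun _ => s, h ∘ (ContinuousLinearMap.proj (R := ℝ) (φ := fun _ : Fin 1 => ℝ) 0),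
    hc.comp (ContinuousLinearMap.contDiff _), ?_, rfl⟩
  apply aux_bound_comp_right _ _ hc
  intro m
  refine ⟨1, fun z => ?_⟩
  rw [norm_iteratedFDeriv_eq_norm_iteratedDeriv]
  exact hb m z

lemma aux_meas [CompleteSpace X] [MeasurableSpace X] [BorelSpace X]
    [SecondCountableTopology X] (U : X → ℝ) (DU : X → X)
    (hU : ∀ x, HasFDerivAt U ((InnerProductSpace.toDual ℝ X) (DU x) : X →L[ℝ] ℝ) x) :
    Measurable DU := by
  borelize (StrongDual ℝ X)
  have h := measurable_fderiv ℝ U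
  have : DU = fun x => (InnerProductSpace.toDual ℝ X).symm (fderiv ℝ U x) := by
    ext x
    rw [(hU x).fderiv]; simp
  rw [this]
  exact (InnerProductSpace.toDual ℝ X).symm.continuous.measurable.comp h

lemma aux_int [CompleteSpace X] [MeasurableSpace X] [BorelSpace X]
    [SecondCountableTopology X] (C : X →L[ℝ] X) (DU : X → X) (hm : Measurable DU)
    (Q : Measure X) [IsProbabilityMeasure Q]
    (hQ2 : Integrable (fun x => ‖x‖ ^ 2) Q)
    (hQU : Integrable (fun x => ‖C (DU x)‖ ^ 2) Q) :
    Integrable (fun x => x + C (DU x)) Q := by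
  have key : ∀ f : X → X, Measurable f → Integrable (fun x => ‖f x‖ ^ 2) Q → Integrable f Q := by
    intro f hf h
    refine (h.add (integrable_const 1)).mono' hf.aestronglyMeasurable (Eventually.of_forall ?_)
    intro x
    simp only [Pi.add_apply]
    nlinarith [sq_nonneg (‖f x‖ - 1)]
  exact (key _ measurable_id hQ2).add (key _ (C.continuous.measurable.comp hm) hQU)

lemma aux_kernel_int [CompleteSpace X] [MeasurableSpace X] [BorelSpace X]
    [SecondCountableTopology X] (b : X → X)
    (Q : Measure X) [IsProbabilityMeasure Q] (hb : Integrable b Q) (s : X) (c : ℂ) :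
    Integrable (fun x => (c - (⟪s, b x⟫ : ℂ) * Complex.I)
        * Complex.exp ((⟪s, x⟫ : ℂ) * Complex.I)) Q := by
  refine Integrable.mul_bdd (c := 1) ?_ ?_ ?_
  · exact (integrable_const _).sub (((hb.const_inner s).ofReal).mul_const _)
  · exact Continuous.aestronglyMeasurable (by fun_prop)
  · exact Eventually.of_forall fun x => by rw [Complex.norm_exp_ofReal_mul_I]

lemma aux_forward [CompleteSpace X]
    [MeasurableSpace X] [BorelSpace X] [SecondCountableTopology X]
    (C : X →L[ℝ] X) (hCsa : IsSelfAdjoint C)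
    (e : HilbertBasis ℕ ℝ X) (l : ℕ → ℝ)
    (hCe : ∀ i, C (e i) = l i • e i) (DU : X → X)
    (Q : Measure X) [IsProbabilityMeasure Q]
    (hb : Integrable (fun x => x + C (DU x)) Q)
    (H : ∀ f : X → ℝ, IsCylindricalCb f →
        ∫ x, steinAR C DU (fun i => e i) l f x ∂Q = 0) (s : X) :
    ∫ x, steinA C DU (fun i => e i) l
        (fun y => Complex.exp ((⟪s, y⟫ : ℂ) * Complex.I)) x ∂Q = 0 := by
  have hcos := H _ (aux_cyl s Real.cos Real.contDiff_cos Real.abs_iteratedDeriv_cos_le_one)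
  have hsin := H _ (aux_cyl s Real.sin Real.contDiff_sin Real.abs_iteratedDeriv_sin_le_one)
  simp_rw [aux_steinAR_inner C hCsa DU e l hCe s _ Real.cos (fun t => -Real.sin t)
    (fun t => -Real.cos t) Real.hasDerivAt_cos (fun t => (Real.hasDerivAt_sin t).neg)] at hcos
  simp_rw [aux_steinAR_inner C hCsa DU e l hCe s _ Real.sin Real.cos
    (fun t => -Real.sin t) Real.hasDerivAt_sin Real.hasDerivAt_cos] at hsin
  simp_rw [aux_steinA_exp C hCsa DU e l hCe s]
  have hint := aux_kernel_int (fun x => x + C (DU x)) Q hb s (-(⟪C s, s⟫ : ℂ))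
  rw [← integral_re_add_im hint]
  have e1 : ∀ x, RCLike.re ((-(⟪C s, s⟫ : ℂ) - (⟪s, x + C (DU x)⟫ : ℂ) * Complex.I)
        * Complex.exp ((⟪s, x⟫ : ℂ) * Complex.I)) =
        ⟪C s, s⟫ * -Real.cos ⟪s, x⟫ - ⟪s, x + C (DU x)⟫ * -Real.sin ⟪s, x⟫ := by
    intro x
    rw [Complex.exp_mul_I, ← Complex.ofReal_cos, ← Complex.ofReal_sin]
    simp [-Complex.ofReal_cos, -Complex.ofReal_sin]
  have e2 : ∀ x, RCLike.im ((-(⟪C s, s⟫ : ℂ) - (⟪s, x + C (DU x)⟫ : ℂ) * Complex.I)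
        * Complex.exp ((⟪s, x⟫ : ℂ) * Complex.I)) =
        ⟪C s, s⟫ * -Real.sin ⟪s, x⟫ - ⟪s, x + C (DU x)⟫ * Real.cos ⟪s, x⟫ := by
    intro x
    rw [Complex.exp_mul_I, ← Complex.ofReal_cos, ← Complex.ofReal_sin]
    simp [-Complex.ofReal_cos, -Complex.ofReal_sin]
    ring
  simp_rw [e1, e2, hcos, hsin]
  simp

noncomputable def auxFG {E : Type*} [NormedAddCommGroup E] [NormedSpace ℝ E]
    (e : ℕ → X) (l : ℕ → ℝ) (T : X →L[ℝ] E) (b : X → X) (g : E → ℂ) (x : X) : ℂ :=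
  (∑' i, (l i : ℂ) * fderiv ℝ (fun z => fderiv ℝ g z (T (e i))) (T x) (T (e i)))
    - fderiv ℝ g (T x) (T (b x))

section schwartz
open scoped SchwartzMap FourierTransform LineDeriv

variable {E : Type*} [NormedAddCommGroup E] [InnerProductSpace ℝ E] [FiniteDimensional ℝ E]
  [MeasurableSpace E] [BorelSpace E]

lemma aux_fourier1 (g : 𝓢(E, ℂ)) (v ξ : E) :
    (𝓕 (∂_{v} g) : 𝓢(E, ℂ)) ξ = (2 * Real.pi * Complex.I) * ((⟪ξ, v⟫ : ℂ) * (𝓕 g : 𝓢(E, ℂ)) ξ) := by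
  have : (inner ℝ · v : E → ℝ).HasTemperateGrowth := by fun_prop
  rw [SchwartzMap.fourier_lineDerivOp_eq]
  simp [this]

lemma aux_inv (g : 𝓢(E, ℂ)) (z : E) :
    g z = ∫ ξ, Complex.exp (((2 * Real.pi * ⟪ξ, z⟫ : ℝ) : ℂ) * Complex.I)
      * (𝓕 g : 𝓢(E, ℂ)) ξ := by
  have h : (𝓕⁻ (𝓕 g : 𝓢(E, ℂ)) : 𝓢(E, ℂ)) = g := FourierTransform.fourierInv_fourier_eq g
  conv_lhs => rw [← h]
  rw [SchwartzMap.fourierInv_coe, Real.fourierInv_eq']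
  rfl

lemma aux_fderiv_schwartz (g : 𝓢(E, ℂ)) (z v : E) :
    fderiv ℝ g z v = ∫ ξ, (((2 * Real.pi * ⟪ξ, v⟫ : ℝ) : ℂ) * Complex.I) *
      (Complex.exp (((2 * Real.pi * ⟪ξ, z⟫ : ℝ) : ℂ) * Complex.I) * (𝓕 g : 𝓢(E, ℂ)) ξ) := by
  rw [← SchwartzMap.lineDerivOp_apply_eq_fderiv, aux_inv]
  congr 1; ext ξ
  rw [aux_fourier1]
  push_cast
  ring

lemma aux_fderiv2_schwartz (g : 𝓢(E, ℂ)) (z v : E) :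
    fderiv ℝ (fun y => fderiv ℝ g y v) z v = ∫ ξ, -(((2 * Real.pi * ⟪ξ, v⟫ : ℝ) : ℂ) ^ 2) *
      (Complex.exp (((2 * Real.pi * ⟪ξ, z⟫ : ℝ) : ℂ) * Complex.I) * (𝓕 g : 𝓢(E, ℂ)) ξ) := by
  have : (fun y => fderiv ℝ g y v) = (∂_{v} g : 𝓢(E, ℂ)) := rfl
  rw [this, aux_fderiv_schwartz]
  congr 1; ext ξ
  rw [aux_fourier1]
  push_cast
  linear_combination (2 * Real.pi * (⟪ξ, v⟫ : ℂ)) ^ 2 *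
      (Complex.exp ((2 * Real.pi * (⟪ξ, z⟫ : ℂ)) * Complex.I) * (𝓕 g : 𝓢(E, ℂ)) ξ) * Complex.I_sq

variable [CompleteSpace X]

lemma aux_FG_schwartz (C : X →L[ℝ] X) (hCsa : IsSelfAdjoint C)
    (e : HilbertBasis ℕ ℝ X) (l : ℕ → ℝ) (hl : ∀ i, 0 < l i) (hltr : Summable l)
    (hCe : ∀ i, C (e i) = l i • e i) (T : X →L[ℝ] E) (b : X → X) (g : 𝓢(E, ℂ)) (x : X)
    (S : E →L[ℝ] X) (hS : ∀ ξ v, ⟪S ξ, v⟫ = 2 * Real.pi * ⟪ξ, T v⟫) :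
    auxFG (fun i => e i) l T b g x = ∫ ξ, ((-(⟪C (S ξ), S ξ⟫ : ℂ) - (⟪S ξ, b x⟫ : ℂ) * Complex.I)
        * Complex.exp ((⟪S ξ, x⟫ : ℂ) * Complex.I)) * (𝓕 g : 𝓢(E, ℂ)) ξ := by
  unfold auxFG
  simp_rw [aux_fderiv2_schwartz, aux_fderiv_schwartz, ← hS]
  set G : 𝓢(E, ℂ) := 𝓕 g with hG
  have i2 : Integrable (fun ξ => ‖ξ‖ ^ 2 * ‖G ξ‖) := G.integrable_pow_mul volume 2
  have i1 : Integrable (fun ξ => ‖ξ‖ * ‖G ξ‖) := by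
    simpa using G.integrable_pow_mul volume 1
  have hGc : Continuous G := G.continuous
  have hsum : HasSum (fun i => ∫ ξ, (l i : ℂ) * (-((⟪S ξ, e i⟫ : ℂ) ^ 2) *
      (Complex.exp ((⟪S ξ, x⟫ : ℂ) * Complex.I) * G ξ)))
      (∫ ξ, -(⟪C (S ξ), S ξ⟫ : ℂ) * (Complex.exp ((⟪S ξ, x⟫ : ℂ) * Complex.I) * G ξ)) := by
    refine hasSum_integral_of_dominated_convergence
      (fun i ξ => l i * (‖S‖ ^ 2 * (‖ξ‖ ^ 2 * ‖G ξ‖))) ?_ ?_ ?_ ?_ ?_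
    · intro i
      exact Continuous.aestronglyMeasurable (by fun_prop)
    · intro i
      refine Eventually.of_forall fun ξ => ?_
      rw [norm_mul, norm_mul, norm_mul, Complex.norm_exp_ofReal_mul_I, norm_neg, norm_pow,
        Complex.norm_real, Complex.norm_real, Real.norm_of_nonneg (hl i).le, one_mul,
        ← mul_assoc (‖S‖ ^ 2), ← mul_pow]
      have h1 : ‖⟪S ξ, e i⟫‖ ≤ ‖S‖ * ‖ξ‖ := by
        refine (norm_inner_le_norm _ _).trans ?_
        rw [e.orthonormal.1 i, mul_one]
        exact S.le_opNorm ξ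
      have := (hl i).le
      gcongr
    · exact Eventually.of_forall fun ξ => hltr.mul_right _
    · simp_rw [tsum_mul_right]
      exact (i2.const_mul _).const_mul _
    · refine Eventually.of_forall fun ξ => ?_
      have h := (Complex.hasSum_ofReal.mpr (aux_hasSum C hCsa e l hCe (S ξ))).mul_right
        (-(Complex.exp ((⟪S ξ, x⟫ : ℂ) * Complex.I) * G ξ))
      rw [neg_mul, ← mul_neg]
      refine aux_hasSum_congr h fun i => ?_
      push_cast; ring
  simp_rw [← integral_const_mul]
  rw [hsum.tsum_eq, ← integral_sub]
  · congr 1; ext ξ; ring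
  · refine (i2.const_mul (‖C‖ * ‖S‖ ^ 2)).mono' (Continuous.aestronglyMeasurable (by fun_prop)) ?_
    refine Eventually.of_forall fun ξ => ?_
    rw [norm_mul, norm_mul, Complex.norm_exp_ofReal_mul_I, norm_neg, Complex.norm_real, one_mul,
        ← mul_assoc]
    gcongr
    calc ‖⟪C (S ξ), S ξ⟫‖ ≤ ‖C (S ξ)‖ * ‖S ξ‖ := norm_inner_le_norm _ _
      _ ≤ (‖C‖ * (‖S‖ * ‖ξ‖)) * (‖S‖ * ‖ξ‖) := by
        gcongr
        · exact C.le_opNorm_of_le (S.le_opNorm ξ)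
        · exact S.le_opNorm ξ
      _ = ‖C‖ * ‖S‖ ^ 2 * ‖ξ‖ ^ 2 := by ring
  · refine (i1.const_mul (‖S‖ * ‖b x‖)).mono' (Continuous.aestronglyMeasurable (by fun_prop)) ?_
    refine Eventually.of_forall fun ξ => ?_
    rw [norm_mul, norm_mul, norm_mul, Complex.norm_exp_ofReal_mul_I, Complex.norm_I,
      Complex.norm_real, one_mul, mul_one, ← mul_assoc]
    gcongr
    calc ‖⟪S ξ, b x⟫‖ ≤ ‖S ξ‖ * ‖b x‖ := norm_inner_le_norm _ _
      _ ≤ (‖S‖ * ‖ξ‖) * ‖b x‖ := by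
        gcongr
        exact S.le_opNorm ξ
      _ = _ := by ring

lemma aux_int_schwartz [MeasurableSpace X] [BorelSpace X] [SecondCountableTopology X]
    (C : X →L[ℝ] X) (hCsa : IsSelfAdjoint C)
    (e : HilbertBasis ℕ ℝ X) (l : ℕ → ℝ) (hl : ∀ i, 0 < l i) (hltr : Summable l)
    (hCe : ∀ i, C (e i) = l i • e i) (T : X →L[ℝ] E) (b : X → X) (g : 𝓢(E, ℂ))
    (Q : Measure X) [IsProbabilityMeasure Q] (hbm : Measurable b) (hb : Integrable b Q)
    (H : ∀ s : X, ∫ x, (-(⟪C s, s⟫ : ℂ) - (⟪s, b x⟫ : ℂ) * Complex.I)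
        * Complex.exp ((⟪s, x⟫ : ℂ) * Complex.I) ∂Q = 0) :
    ∫ x, auxFG (fun i => e i) l T b g x ∂Q = 0 := by
  obtain ⟨S, hS⟩ : ∃ S : E →L[ℝ] X, ∀ ξ v, ⟪S ξ, v⟫ = 2 * Real.pi * ⟪ξ, T v⟫ := by
    refine ⟨(2 * Real.pi) • ContinuousLinearMap.adjoint T, fun ξ v => ?_⟩
    rw [smul_apply, real_inner_smul_left,
      ContinuousLinearMap.adjoint_inner_left]
  simp_rw [aux_FG_schwartz C hCsa e l hl hltr hCe T b g _ S hS]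
  set G : 𝓢(E, ℂ) := 𝓕 g with hG
  have i2 : Integrable (fun ξ => ‖ξ‖ ^ 2 * ‖G ξ‖) := G.integrable_pow_mul volume 2
  have i1 : Integrable (fun ξ => ‖ξ‖ * ‖G ξ‖) := by
    simpa using G.integrable_pow_mul volume 1
  have hGc : Continuous G := G.continuous
  rw [integral_integral_swap]
  · simp_rw [integral_mul_const, H]
    simp
  · have hdom : Integrable (fun p : X × E => (1 : ℝ) * ((‖C‖ * ‖S‖ ^ 2) * (‖p.2‖ ^ 2 * ‖G p.2‖))
        + ‖b p.1‖ * (‖S‖ * (‖p.2‖ * ‖G p.2‖))) (Q.prod volume) :=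
      ((integrable_const (1 : ℝ)).mul_prod (i2.const_mul _)).add
        (hb.norm.mul_prod (i1.const_mul _))
    refine hdom.mono' ?_ ?_
    · have m1 : Measurable (fun p : X × E => (⟪S p.2, b p.1⟫ : ℝ)) :=
        ((S.continuous.measurable.comp measurable_snd).inner (hbm.comp measurable_fst))
      have m2 : Measurable (fun p : X × E => (⟪S p.2, p.1⟫ : ℝ)) :=
        ((S.continuous.measurable.comp measurable_snd).inner measurable_fst)
      have m3 : Measurable (fun p : X × E => (⟪C (S p.2), S p.2⟫ : ℝ)) :=
        (((C.comp S).continuous.measurable.comp measurable_snd).inner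
          (S.continuous.measurable.comp measurable_snd))
      have m4 : Measurable (fun p : X × E => G p.2) := hGc.measurable.comp measurable_snd
      apply Measurable.aestronglyMeasurable
      unfold Function.uncurry
      fun_prop
    · refine Eventually.of_forall fun p => ?_
      obtain ⟨x, ξ⟩ := p
      simp only [Function.uncurry]
      rw [norm_mul, norm_mul, Complex.norm_exp_ofReal_mul_I, mul_one]
      have hSξ := S.le_opNorm ξ
      have h1 : ‖(⟪C (S ξ), S ξ⟫ : ℂ)‖ ≤ ‖C‖ * ‖S‖ ^ 2 * ‖ξ‖ ^ 2 := by
        rw [Complex.norm_real]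
        calc ‖⟪C (S ξ), S ξ⟫‖ ≤ ‖C (S ξ)‖ * ‖S ξ‖ := norm_inner_le_norm _ _
          _ ≤ (‖C‖ * (‖S‖ * ‖ξ‖)) * (‖S‖ * ‖ξ‖) := by
            gcongr
            exact C.le_opNorm_of_le hSξ
          _ = ‖C‖ * ‖S‖ ^ 2 * ‖ξ‖ ^ 2 := by ring
      have h2 : ‖(⟪S ξ, b x⟫ : ℂ) * Complex.I‖ ≤ (‖S‖ * ‖ξ‖) * ‖b x‖ := by
        rw [norm_mul, Complex.norm_I, mul_one, Complex.norm_real]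
        refine (norm_inner_le_norm _ _).trans ?_
        gcongr
      have h3 := norm_sub_le (-(⟪C (S ξ), S ξ⟫ : ℂ)) ((⟪S ξ, b x⟫ : ℂ) * Complex.I)
      rw [norm_neg] at h3
      calc _ ≤ (‖C‖ * ‖S‖ ^ 2 * ‖ξ‖ ^ 2 + (‖S‖ * ‖ξ‖) * ‖b x‖) * ‖G ξ‖ := by
            gcongr
            linarith
        _ = _ := by ring

end schwartz

section approx
open scoped SchwartzMap

variable {E : Type*} [NormedAddCommGroup E] [InnerProductSpace ℝ E] [FiniteDimensional ℝ E]

lemma aux_fderiv2 {F : Type*} [NormedAddCommGroup F] [NormedSpace ℝ F]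
    (g : E → F) (hg : ContDiff ℝ (⊤ : ℕ∞) g) (z v w : E) :
    fderiv ℝ (fun y => fderiv ℝ g y v) z w = fderiv ℝ (fderiv ℝ g) z w v := by
  have h : Differentiable ℝ (fderiv ℝ g) :=
    (hg.fderiv_right (m := (⊤ : ℕ∞)) (by simp)).differentiable (by simp)
  rw [fderiv_clm_apply (h z) (differentiableAt_const v)]
  simp

lemma aux_norm1 {F : Type*} [NormedAddCommGroup F] [NormedSpace ℝ F] (g : E → F) (z : E) :
    ‖fderiv ℝ g z‖ = ‖iteratedFDeriv ℝ 1 g z‖ := by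
  rw [← norm_iteratedFDeriv_fderiv, norm_iteratedFDeriv_zero]

lemma aux_norm2 {F : Type*} [NormedAddCommGroup F] [NormedSpace ℝ F] (g : E → F) (z : E) :
    ‖fderiv ℝ (fderiv ℝ g) z‖ = ‖iteratedFDeriv ℝ 2 g z‖ := by
  rw [← norm_iteratedFDeriv_fderiv, ← norm_iteratedFDeriv_fderiv, norm_iteratedFDeriv_zero]

lemma aux_term_bound (l : ℕ → ℝ) (hl : ∀ i, 0 < l i) (e : ℕ → X) (he : ∀ i, ‖e i‖ = 1)
    (T : X →L[ℝ] E) (g : E → ℂ) (hg : ContDiff ℝ (⊤ : ℕ∞) g) (B : ℝ)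
    (hB : ∀ z, ‖iteratedFDeriv ℝ 2 g z‖ ≤ B) (i : ℕ) (x : X) :
    ‖(l i : ℂ) * fderiv ℝ (fun z => fderiv ℝ g z (T (e i))) (T x) (T (e i))‖
      ≤ l i * (B * ‖T‖ ^ 2) := by
  rw [aux_fderiv2 g hg, norm_mul, Complex.norm_real, Real.norm_of_nonneg (hl i).le]
  have h0 := (hl i).le
  have hT : ‖T (e i)‖ ≤ ‖T‖ := by simpa [he i] using T.le_opNorm (e i)
  have hB' : ‖fderiv ℝ (fderiv ℝ g) (T x)‖ ≤ B := by rw [aux_norm2]; exact hB _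
  gcongr
  refine (ContinuousLinearMap.le_opNorm₂ _ _ _).trans ?_
  rw [mul_assoc, ← sq]
  have : 0 ≤ B := le_trans (norm_nonneg (fderiv ℝ (fderiv ℝ g) (T x))) hB'
  gcongr

lemma aux_FG_bound (l : ℕ → ℝ) (hl : ∀ i, 0 < l i) (hltr : Summable l)
    (e : ℕ → X) (he : ∀ i, ‖e i‖ = 1)
    (T : X →L[ℝ] E) (b : X → X) (g : E → ℂ) (hg : ContDiff ℝ (⊤ : ℕ∞) g) (B1 B : ℝ)
    (hB1 : ∀ z, ‖iteratedFDeriv ℝ 1 g z‖ ≤ B1)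
    (hB : ∀ z, ‖iteratedFDeriv ℝ 2 g z‖ ≤ B) (x : X) :
    ‖auxFG e l T b g x‖ ≤ (∑' i, l i) * (B * ‖T‖ ^ 2) + B1 * ‖T‖ * ‖b x‖ := by
  unfold auxFG
  refine (norm_sub_le _ _).trans (add_le_add ?_ ?_)
  · rw [← tsum_mul_right]
    exact tsum_of_norm_bounded (hltr.mul_right _).hasSum
      (fun i => aux_term_bound l hl e he T g hg B hB i x)
  · have h1 : ‖fderiv ℝ g (T x)‖ ≤ B1 := by rw [aux_norm1]; exact hB1 _
    refine (ContinuousLinearMap.le_opNorm _ _).trans ?_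
    rw [mul_assoc]
    have : 0 ≤ B1 := (norm_nonneg _).trans h1
    gcongr
    exact T.le_opNorm _

lemma aux_FG_meas [CompleteSpace X] [MeasurableSpace X] [BorelSpace X] [SecondCountableTopology X]
    (l : ℕ → ℝ) (hl : ∀ i, 0 < l i) (hltr : Summable l)
    (e : ℕ → X) (he : ∀ i, ‖e i‖ = 1)
    (T : X →L[ℝ] E) (b : X → X) (hbm : Measurable b) (g : E → ℂ) (hg : ContDiff ℝ (⊤ : ℕ∞) g)
    (B : ℝ) (hB : ∀ z, ‖iteratedFDeriv ℝ 2 g z‖ ≤ B) (Q : Measure X) :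
    AEStronglyMeasurable (auxFG e l T b g) Q := by
  unfold auxFG
  have hc1 : ContDiff ℝ (⊤ : ℕ∞) (fderiv ℝ g) := hg.fderiv_right (by simp)
  have hc2 : ContDiff ℝ (⊤ : ℕ∞) (fderiv ℝ (fderiv ℝ g)) := hc1.fderiv_right (by simp)
  refine AEStronglyMeasurable.sub ?_ ?_
  · refine Continuous.aestronglyMeasurable ?_
    refine continuous_tsum ?_ (hltr.mul_right (B * ‖T‖ ^ 2))
      (fun i x => aux_term_bound l hl e he T g hg B hB i x)
    intro i
    simp_rw [aux_fderiv2 g hg]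
    have := hc2.continuous
    fun_prop
  · have h1 : AEStronglyMeasurable (fun x => fderiv ℝ g (T x)) Q :=
      (hc1.continuous.comp T.continuous).aestronglyMeasurable
    have h2 : AEStronglyMeasurable (fun x => T (b x)) Q :=
      T.continuous.comp_aestronglyMeasurable hbm.aestronglyMeasurable
    exact (isBoundedBilinearMap_apply (𝕜 := ℝ) (E := E) (F := ℂ)).continuous.comp_aestronglyMeasurable
      (h1.prodMk h2)

lemma aux_FG_congr (l : ℕ → ℝ) (e : ℕ → X)
    (T : X →L[ℝ] E) (b : X → X) (g g' : E → ℂ) (x : X) (h : g =ᶠ[nhds (T x)] g') :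
    auxFG e l T b g x = auxFG e l T b g' x := by
  unfold auxFG
  rw [h.fderiv_eq]
  have : ∀ v, fderiv ℝ (fun z => fderiv ℝ g z v) (T x)
      = fderiv ℝ (fun z => fderiv ℝ g' z v) (T x) := by
    intro v
    apply Filter.EventuallyEq.fderiv_eq
    filter_upwards [h.fderiv (𝕜 := ℝ)] with z hz
    rw [hz]
  simp_rw [this]

/-- cutoff -/
lemma aux_cutoff : ∃ χ : 𝓢(E, ℂ), HasCompactSupport χ ∧ ∀ z, ‖z‖ < 1 → χ z = 1 := by
  let c : ContDiffBump (0 : E) := ⟨1, 2, one_pos, one_lt_two⟩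
  have hcs : HasCompactSupport (fun z => ((c z : ℝ) : ℂ)) :=
    c.hasCompactSupport.comp_left (g := fun t : ℝ => (t : ℂ)) (by simp)
  have hcd : ContDiff ℝ (⊤ : ℕ∞) (fun z => ((c z : ℝ) : ℂ)) :=
    Complex.ofRealCLM.contDiff.comp c.contDiff
  refine ⟨hcs.toSchwartzMap hcd, hcs, fun z hz => ?_⟩
  change ((c z : ℝ) : ℂ) = 1
  rw [c.one_of_mem_closedBall (by simpa using hz.le)]
  simp

lemma aux_cut_bound (χ : 𝓢(E, ℂ)) (g : E → ℂ) (hg : ContDiff ℝ (⊤ : ℕ∞) g)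
    (hB : ∀ m : ℕ, ∃ B : ℝ, ∀ z, ‖iteratedFDeriv ℝ m g z‖ ≤ B) (m : ℕ) :
    ∃ B : ℝ, ∀ a : ℝ, 0 ≤ a → a ≤ 1 → ∀ z,
      ‖iteratedFDeriv ℝ m (fun y => χ (a • y) * g y) z‖ ≤ B := by
  choose B hB using hB
  refine ⟨∑ i ∈ Finset.range (m + 1), (m.choose i : ℝ) * (SchwartzMap.seminorm ℝ 0 i χ)
    * B (m - i), fun a ha ha1 z => ?_⟩
  have hχ : ContDiff ℝ (⊤ : ℕ∞) (fun y => χ (a • y)) :=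
    (χ.smooth (⊤ : ℕ∞)).comp (contDiff_const_smul a)
  refine (norm_iteratedFDeriv_mul_le hχ hg z (by exact_mod_cast le_top)).trans ?_
  refine Finset.sum_le_sum fun i _ => ?_
  have h1 : ‖iteratedFDeriv ℝ i (fun y => χ (a • y)) z‖ ≤ SchwartzMap.seminorm ℝ 0 i χ := by
    rw [iteratedFDeriv_comp_const_smul a (χ.smooth i)]
    rw [norm_smul, norm_pow, Real.norm_of_nonneg ha]
    refine (mul_le_of_le_one_left (norm_nonneg _) (pow_le_one₀ ha ha1)).trans ?_
    exact SchwartzMap.norm_iteratedFDeriv_le_seminorm ℝ χ i _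
  have h2 := hB (m - i) z
  have : 0 ≤ SchwartzMap.seminorm ℝ 0 i χ := (norm_nonneg _).trans h1
  gcongr

lemma aux_int_cb [CompleteSpace X] [MeasurableSpace X] [BorelSpace X] [SecondCountableTopology X]
    [MeasurableSpace E] [BorelSpace E]
    (C : X →L[ℝ] X) (hCsa : IsSelfAdjoint C)
    (e : HilbertBasis ℕ ℝ X) (l : ℕ → ℝ) (hl : ∀ i, 0 < l i) (hltr : Summable l)
    (hCe : ∀ i, C (e i) = l i • e i) (T : X →L[ℝ] E) (b : X → X)
    (g : E → ℂ) (hg : ContDiff ℝ (⊤ : ℕ∞) g)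
    (hB : ∀ m : ℕ, ∃ B : ℝ, ∀ z, ‖iteratedFDeriv ℝ m g z‖ ≤ B)
    (Q : Measure X) [IsProbabilityMeasure Q] (hbm : Measurable b) (hb : Integrable b Q)
    (H : ∀ s : X, ∫ x, (-(⟪C s, s⟫ : ℂ) - (⟪s, b x⟫ : ℂ) * Complex.I)
        * Complex.exp ((⟪s, x⟫ : ℂ) * Complex.I) ∂Q = 0) :
    ∫ x, auxFG (fun i => e i) l T b g x ∂Q = 0 := by
  obtain ⟨χ, hχ, hχ1⟩ := aux_cutoff (E := E)
  obtain ⟨B1, hB1⟩ := aux_cut_bound χ g hg hB 1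
  obtain ⟨B2, hB2⟩ := aux_cut_bound χ g hg hB 2
  have he : ∀ i, ‖e i‖ = 1 := e.orthonormal.1
  let a : ℕ → ℝ := fun k => 1 / ((k : ℝ) + 1)
  have ha0 : ∀ k, 0 < a k := fun k => by positivity
  have ha1 : ∀ k, a k ≤ 1 := fun k => by
    rw [div_le_one (by positivity)]; linarith [(Nat.cast_nonneg k : (0 : ℝ) ≤ k)]
  have hat : Tendsto a atTop (nhds 0) := tendsto_one_div_add_atTop_nhds_zero_nat
  let gk : ℕ → E → ℂ := fun k y => χ (a k • y) * g y
  have hgk : ∀ k, ContDiff ℝ (⊤ : ℕ∞) (gk k) := fun k =>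
    ((χ.smooth (⊤ : ℕ∞)).comp (contDiff_const_smul (a k))).mul hg
  have hcs : ∀ k, HasCompactSupport (gk k) := fun k => by
    have : HasCompactSupport (fun y => χ (a k • y)) := hχ.comp_smul (ha0 k).ne'
    exact this.mul_right
  have hz : ∀ k, ∫ x, auxFG (fun i => e i) l T b (gk k) x ∂Q = 0 := fun k =>
    aux_int_schwartz C hCsa e l hl hltr hCe T b ((hcs k).toSchwartzMap (hgk k)) Q hbm hb H
  have hlim : Tendsto (fun k => ∫ x, auxFG (fun i => e i) l T b (gk k) x ∂Q) atTop
      (nhds (∫ x, auxFG (fun i => e i) l T b g x ∂Q)) := by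
    refine tendsto_integral_of_dominated_convergence
      (fun x => (∑' i, l i) * (B2 * ‖T‖ ^ 2) + B1 * ‖T‖ * ‖b x‖) ?_ ?_ ?_ ?_
    · intro k
      exact aux_FG_meas l hl hltr _ he T b hbm (gk k) (hgk k) B2 (hB2 (a k) (ha0 k).le (ha1 k)) Q
    · exact (integrable_const _).add (hb.norm.const_mul _)
    · intro k
      exact Eventually.of_forall fun x => aux_FG_bound l hl hltr _ he T b (gk k) (hgk k) B1 B2
        (hB1 (a k) (ha0 k).le (ha1 k)) (hB2 (a k) (ha0 k).le (ha1 k)) x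
    · refine Eventually.of_forall fun x => ?_
      refine tendsto_const_nhds.congr' ?_
      have h1 : Tendsto (fun k => ‖a k • T x‖) atTop (nhds 0) := by
        have := (hat.smul_const (T x)).norm
        simpa using this
      filter_upwards [h1.eventually_lt_const one_pos] with k hk
      refine (aux_FG_congr l _ T b _ _ x ?_).symm
      have : ∀ᶠ y in nhds (T x), ‖a k • y‖ < 1 :=
        (Continuous.tendsto (by fun_prop : Continuous fun y : E => ‖a k • y‖) (T x)).eventually_lt_const hk
      filter_upwards [this] with y hy
      change χ (a k • y) * g y = g y
      rw [hχ1 _ hy, one_mul]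
  simp_rw [hz] at hlim
  exact tendsto_nhds_unique hlim tendsto_const_nhds

lemma aux_steinAR_FG (C : X →L[ℝ] X) (DU : X → X) (e : ℕ → X) (l : ℕ → ℝ)
    (T : X →L[ℝ] E) (g : E → ℝ) (hg : ContDiff ℝ (⊤ : ℕ∞) g) (x : X) :
    ((steinAR C DU e l (g ∘ T) x : ℝ) : ℂ)
      = auxFG e l T (fun x => x + C (DU x)) (fun z => (g z : ℂ)) x := by
  have hgd : Differentiable ℝ g := hg.differentiable (by simp)
  have h1 : ∀ z v, fderiv ℝ (fun z => (g z : ℂ)) z v = ((fderiv ℝ g z v : ℝ) : ℂ) := by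
    intro z v
    have := (Complex.ofRealCLM.hasFDerivAt (x := g z)).comp z (hgd z).hasFDerivAt
    have h2 : fderiv ℝ (fun z => (g z : ℂ)) z = _ := this.fderiv
    rw [h2]; simp
  have h1' : ∀ v, Differentiable ℝ (fun z => fderiv ℝ g z v) := by
    intro v
    have h : Differentiable ℝ (fderiv ℝ g) :=
      (hg.fderiv_right (m := (⊤ : ℕ∞)) (by simp)).differentiable (by simp)
    fun_prop
  have h2 : ∀ z v, fderiv ℝ (fun z => fderiv ℝ (fun z => (g z : ℂ)) z v) z v
      = ((fderiv ℝ (fun z => fderiv ℝ g z v) z v : ℝ) : ℂ) := by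
    intro z v
    simp_rw [h1]
    have := (Complex.ofRealCLM.hasFDerivAt (x := fderiv ℝ g z v)).comp z (h1' v z).hasFDerivAt
    have h2 : fderiv ℝ (fun z => ((fderiv ℝ g z v : ℝ) : ℂ)) z = _ := this.fderiv
    rw [h2]; simp
  have h3 : ∀ y v, fderiv ℝ (g ∘ T) y v = fderiv ℝ g (T y) (T v) := by
    intro y v
    rw [((hgd (T y)).hasFDerivAt.comp y T.hasFDerivAt).fderiv]; rfl
  have h4 : ∀ y v, fderiv ℝ (fun y => fderiv ℝ (g ∘ T) y v) y v
      = fderiv ℝ (fun z => fderiv ℝ g z (T v)) (T y) (T v) := by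
    intro y v
    simp_rw [h3]
    have := ((h1' (T v) (T y)).hasFDerivAt.comp y T.hasFDerivAt)
    have h5 : fderiv ℝ (fun y => fderiv ℝ g (T y) (T v)) y = _ := this.fderiv
    rw [h5]; rfl
  unfold steinAR auxFG
  simp_rw [h2, h1, h4, h3]
  push_cast
  rfl

end approx

lemma aux_backward [CompleteSpace X]
    [MeasurableSpace X] [BorelSpace X] [SecondCountableTopology X]
    (C : X →L[ℝ] X) (hCsa : IsSelfAdjoint C)
    (e : HilbertBasis ℕ ℝ X) (l : ℕ → ℝ) (hl : ∀ i, 0 < l i)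
    (hCe : ∀ i, C (e i) = l i • e i) (hltr : Summable l) (DU : X → X) (hm : Measurable DU)
    (Q : Measure X) [IsProbabilityMeasure Q]
    (hb : Integrable (fun x => x + C (DU x)) Q)
    (H : ∀ s : X, ∫ x, steinA C DU (fun i => e i) l
        (fun y => Complex.exp ((⟪s, y⟫ : ℂ) * Complex.I)) x ∂Q = 0)
    (f : X → ℝ) (hf : IsCylindricalCb f) :
    ∫ x, steinAR C DU (fun i => e i) l f x ∂Q = 0 := by
  obtain ⟨n, L, φ, hφ, hB, rfl⟩ := hf
  simp_rw [aux_steinA_exp C hCsa DU e l hCe] at H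
  let P : EuclideanSpace ℝ (Fin n) →L[ℝ] (Fin n → ℝ) :=
    (EuclideanSpace.equiv (Fin n) ℝ).toContinuousLinearMap
  let T0 : X →L[ℝ] (Fin n → ℝ) := ContinuousLinearMap.pi fun j => innerSL ℝ (L j)
  let T : X →L[ℝ] EuclideanSpace ℝ (Fin n) :=
    (EuclideanSpace.equiv (Fin n) ℝ).symm.toContinuousLinearMap.comp T0
  have hfT : (fun x => φ (fun j => ⟪L j, x⟫)) = (φ ∘ P) ∘ T := by
    ext x
    simp [P, T, T0, Function.comp_def]
    rfl
  have hg : ContDiff ℝ (⊤ : ℕ∞) (φ ∘ P) := hφ.comp P.contDiff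
  have hBg := aux_bound_comp_right P φ hφ hB
  have hgc : ContDiff ℝ (⊤ : ℕ∞) (fun z => ((φ ∘ P) z : ℂ)) := Complex.ofRealCLM.contDiff.comp hg
  have hBc : ∀ m : ℕ, ∃ B : ℝ, ∀ z, ‖iteratedFDeriv ℝ m (fun z => ((φ ∘ P) z : ℂ)) z‖ ≤ B := by
    intro m
    obtain ⟨B, hB⟩ := hBg m
    refine ⟨B, fun z => ?_⟩
    have := Complex.ofRealLI.norm_iteratedFDeriv_comp_left (hg.contDiffAt (x := z)) (i := m)
      (by exact_mod_cast le_top)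
    exact this.le.trans (hB z)
  have hbm : Measurable (fun x => x + C (DU x)) :=
    measurable_id.add (C.continuous.measurable.comp hm)
  have key := aux_int_cb C hCsa e l hl hltr hCe T _ _ hgc hBc Q hbm hb H
  simp_rw [← aux_steinAR_FG C DU (fun i => e i) l T (φ ∘ P) hg] at key
  rw [integral_complex_ofReal] at key
  rw [hfT]
  exact_mod_cast key

end helpers

/-- **Exponential test functions characterise the measure equation** (Proposition 5):
`∫ A f dQ = 0` for every `f ∈ FC_b^∞(X)` iff `∫ A(e^{i⟪s,·⟫}) dQ = 0` for every `s`. -/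
theorem measure_equation_iff_exponentials
    {X : Type*} [NormedAddCommGroup X] [InnerProductSpace ℝ X] [CompleteSpace X]
    [MeasurableSpace X] [BorelSpace X] [SecondCountableTopology X]
    -- the covariance operator and its eigendecomposition
    (C : X →L[ℝ] X) (hCsa : IsSelfAdjoint C)
    (e : HilbertBasis ℕ ℝ X) (l : ℕ → ℝ) (hl : ∀ i, 0 < l i)
    (hCe : ∀ i, C (e i) = l i • e i) (hltr : Summable l)
    -- the potential `U` and its gradient `DU`
    (U : X → ℝ) (DU : X → X)
    (hU : ∀ x, HasFDerivAt U ((InnerProductSpace.toDual ℝ X) (DU x) : X →L[ℝ] ℝ) x)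
    -- the measure `Q` and its moment conditions
    (Q : Measure X) [IsProbabilityMeasure Q]
    (hQ2 : Integrable (fun x => ‖x‖ ^ 2) Q)
    (hQU : Integrable (fun x => ‖C (DU x)‖ ^ 2) Q) :
    (∀ f : X → ℝ, IsCylindricalCb f →
        ∫ x, steinAR C DU (fun i => e i) l f x ∂Q = 0) ↔
    (∀ s : X, ∫ x, steinA C DU (fun i => e i) l
        (fun y => Complex.exp ((⟪s, y⟫ : ℂ) * Complex.I)) x ∂Q = 0) := by
  have hm := aux_meas U DU hU
  have hb := aux_int C DU hm Q hQ2 hQU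
  exact ⟨fun H s => aux_forward C hCsa e l hCe DU Q hb H s,
    fun H f hf => aux_backward C hCsa e l hl hCe hltr DU hm Q hb H f hf⟩
end

section
/- Stein identity for Gibbs measures on exponential test functions (proved within Theorem 3): assume in addition that ∫ (‖x‖ + ‖C DU(x)‖) dP(x) < ∞. Then for every s ∈ X, ∫_X Γ(e^{i⟨s,·⟩})(x) dP(x) = 0 in X_ℂ, and consequently ∫_X A(e^{i⟨s,·⟩})(x) dP(x) = 0. -/
open MeasureTheory ProbabilityTheory Complex Filter
open scoped RealInnerProductSpace

/-- Real part of `Γ f(x) = C Df(x) − (x + C DU(x)) f(x) ∈ X_ℂ`. -/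
noncomputable def steinGammaRe {X : Type*} [NormedAddCommGroup X] [InnerProductSpace ℝ X]
    [CompleteSpace X] (C : X →L[ℝ] X) (DU : X → X) (f : X → ℂ) (x : X) : X :=
  C ((InnerProductSpace.toDual ℝ X).symm (Complex.reCLM.comp (fderiv ℝ f x)))
    - (f x).re • (x + C (DU x))

/-- Imaginary part of `Γ f(x) = C Df(x) − (x + C DU(x)) f(x) ∈ X_ℂ`. -/
noncomputable def steinGammaIm {X : Type*} [NormedAddCommGroup X] [InnerProductSpace ℝ X]
    [CompleteSpace X] (C : X →L[ℝ] X) (DU : X → X) (f : X → ℂ) (x : X) : X :=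
  C ((InnerProductSpace.toDual ℝ X).symm (Complex.imCLM.comp (fderiv ℝ f x)))
    - (f x).im • (x + C (DU x))

/-- One-dimensional Gaussian integration by parts. -/
lemma stein_gauss_one_dim {v : NNReal} (hv : v ≠ 0) {g g' : ℝ → ℂ}
    (hg : ∀ t, HasDerivAt g (g' t) t) (hi : Integrable g (gaussianReal 0 v))
    (hi' : Integrable (fun t => (v : ℂ) * g' t - (t : ℂ) * g t) (gaussianReal 0 v)) :
    ∫ t, ((v : ℂ) * g' t - (t : ℂ) * g t) ∂(gaussianReal 0 v) = 0 := by
  have hvr : (v : ℝ) ≠ 0 := by exact_mod_cast hv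
  have hvc : (v : ℂ) ≠ 0 := by exact_mod_cast hvr
  have key : ∀ f : ℝ → ℂ, Integrable f (gaussianReal 0 v) →
      Integrable (fun t => gaussianPDFReal 0 v t • f t) := by
    intro f hf
    rw [gaussianReal_of_var_ne_zero _ hv,
      integrable_withDensity_iff_integrable_smul' (measurable_gaussianPDF _ _)
        (ae_of_all _ fun _ => gaussianPDF_lt_top)] at hf
    simpa using hf
  have hpdf : ∀ t, HasDerivAt (gaussianPDFReal 0 v) (-(t / v) * gaussianPDFReal 0 v t) t := by
    intro t
    rw [gaussianPDFReal_def]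
    have h1 : HasDerivAt (fun x : ℝ => -(x - 0) ^ 2 / (2 * (v : ℝ))) (-(t / v)) t := by
      have := ((((hasDerivAt_id t).sub_const 0).pow 2).neg).div_const (2 * (v : ℝ))
      refine this.congr_deriv ?_
      simp
      field_simp
    refine (h1.exp.const_mul _).congr_deriv ?_
    ring
  rw [integral_gaussianReal_eq_integral_smul hv]
  have h0 := integral_eq_zero_of_hasDerivAt_of_integrable
    (f := fun t => (v : ℂ) * (gaussianPDFReal 0 v t • g t))
    (f' := fun t => gaussianPDFReal 0 v t • ((v : ℂ) * g' t - (t : ℂ) * g t)) ?_ (key _ hi')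
    ((key _ hi).const_mul _)
  · exact h0
  · intro t
    refine (((hpdf t).smul (hg t)).const_mul (v : ℂ)).congr_deriv ?_
    simp only [Complex.real_smul]
    push_cast
    field_simp
    ring

lemma stein_quad_nonneg {X : Type*} [NormedAddCommGroup X] [InnerProductSpace ℝ X]
    [CompleteSpace X] (C : X →L[ℝ] X) (hCsa : IsSelfAdjoint C)
    (e : HilbertBasis ℕ ℝ X) (l : ℕ → ℝ) 
    (hCe : ∀ i, C (e i) = l i • e i) (y : X) :
    HasSum (fun i => l i * ⟪y, e i⟫ ^ 2) ⟪C y, y⟫ := by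
  have := e.hasSum_inner_mul_inner (C y) y
  suffices hfun : (fun i => l i * ⟪y, e i⟫ ^ 2) = fun i => ⟪C y, e i⟫ * ⟪e i, y⟫ by
    rw [hfun]; exact this
  funext i
  have : ⟪C y, e i⟫ = ⟪y, C (e i)⟫ := by
    rw [← ContinuousLinearMap.adjoint_inner_right, hCsa.adjoint_eq]
  rw [this, hCe, inner_smul_right, real_inner_comm y (e i)]
  ring

lemma stein_charFun {X : Type*} [NormedAddCommGroup X] [InnerProductSpace ℝ X]
    [MeasurableSpace X] [BorelSpace X]
    (C : X →L[ℝ] X) (hpos : ∀ y, 0 ≤ ⟪C y, y⟫) (NC : Measure X)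
    (hNC : ∀ y : X, Measure.map (fun x => ⟪y, x⟫) NC
      = gaussianReal 0 (Real.toNNReal ⟪C y, y⟫)) (y : X) :
    charFun NC y = Complex.exp (-(⟪C y, y⟫ : ℝ) / 2) := by
  have h := charFun_gaussianReal (μ := 0) (v := Real.toNNReal ⟪C y, y⟫) 1
  rw [← hNC, charFun_apply_real, integral_map (by fun_prop) (by fun_prop)] at h
  rw [charFun_apply]
  have e1 : ((Real.toNNReal ⟪C y, y⟫ : NNReal) : ℂ) = ((⟪C y, y⟫ : ℝ) : ℂ) := by
    rw [← Complex.ofReal_inj.2 (Real.coe_toNNReal _ (hpos y))]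
  rw [e1] at h
  simp only [Complex.ofReal_one, one_mul, Complex.ofReal_zero, zero_mul, zero_sub, one_pow, mul_one] at h
  have h3 : ∀ x : X, ⟪x, y⟫ = ⟪y, x⟫ := fun x => real_inner_comm _ _
  have h4 : ∫ x, Complex.exp ((⟪x, y⟫ : ℝ) * I) ∂NC = ∫ x, Complex.exp ((⟪y, x⟫ : ℝ) * I) ∂NC :=
    integral_congr_ae (ae_of_all _ fun x => by simp only [h3 x])
  rw [h4, h]
  congr 1
  ring

/-- Resampling one coordinate leaves the Gaussian measure invariant. -/
lemma stein_resample {X : Type*} [NormedAddCommGroup X] [InnerProductSpace ℝ X] [CompleteSpace X]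
    [MeasurableSpace X] [BorelSpace X] [SecondCountableTopology X]
    (C : X →L[ℝ] X) (hCsa : IsSelfAdjoint C) (hpos : ∀ y, 0 ≤ ⟪C y, y⟫)
    (u : X) (hu : ‖u‖ = 1) (c : NNReal) (hCu : C u = (c : ℝ) • u)
    (NC : Measure X) [IsProbabilityMeasure NC]
    (hNC : ∀ y : X, Measure.map (fun x => ⟪y, x⟫) NC
      = gaussianReal 0 (Real.toNNReal ⟪C y, y⟫)) :
    (NC.prod (gaussianReal 0 c)).map (fun p : X × ℝ => (p.1 - ⟪u, p.1⟫ • u) + p.2 • u) = NC := by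
  have hm : Measurable (fun p : X × ℝ => (p.1 - ⟪u, p.1⟫ • u) + p.2 • u) := by fun_prop
  have := Measure.isProbabilityMeasure_map (μ := NC.prod (gaussianReal 0 c)) hm.aemeasurable
  apply Measure.ext_of_charFun
  funext y
  rw [stein_charFun C hpos NC hNC y, charFun_apply, integral_map hm.aemeasurable (by fun_prop)]
  have h1 : ∀ p : X × ℝ, Complex.exp ((⟪(p.1 - ⟪u, p.1⟫ • u) + p.2 • u, y⟫ : ℝ) * I) =
      Complex.exp ((⟪p.1, y - ⟪u, y⟫ • u⟫ : ℝ) * I) *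
        Complex.exp ((⟪u, y⟫ : ℝ) * (p.2 : ℝ) * I) := by
    intro p
    rw [← Complex.exp_add]
    congr 1
    rw [← add_mul]
    congr 1
    rw [← Complex.ofReal_mul, ← Complex.ofReal_add]
    congr 1
    simp only [inner_add_left, inner_sub_left, inner_sub_right, inner_smul_left, inner_smul_right,
      real_inner_comm p.1 u, conj_trivial]
    ring
  simp_rw [h1]
  rw [integral_prod_mul (μ := NC) (ν := gaussianReal 0 c)
    (fun x : X => Complex.exp ((⟪x, y - ⟪u, y⟫ • u⟫ : ℝ) * I))
    (fun t : ℝ => Complex.exp ((⟪u, y⟫ : ℝ) * (t : ℝ) * I)),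
    ← charFun_apply, ← charFun_apply_real, stein_charFun C hpos NC hNC, charFun_gaussianReal,
    ← Complex.exp_add]
  congr 1
  have hs : ⟪C y, u⟫ = c * ⟪u, y⟫ := by
    rw [← ContinuousLinearMap.adjoint_inner_right, hCsa.adjoint_eq, hCu, inner_smul_right,
      real_inner_comm]
  have h2 : ⟪C (y - ⟪u, y⟫ • u), y - ⟪u, y⟫ • u⟫ = ⟪C y, y⟫ - c * ⟪u, y⟫ ^ 2 := by
    simp only [map_sub, map_smul, hCu, inner_sub_left, inner_sub_right, inner_smul_left,
      inner_smul_right, hs, conj_trivial, real_inner_self_eq_norm_sq, hu]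
    ring
  rw [h2]
  push_cast
  ring


lemma stein_core {X : Type*} [NormedAddCommGroup X] [InnerProductSpace ℝ X] [CompleteSpace X]
    [MeasurableSpace X] [BorelSpace X] [SecondCountableTopology X]
    (C : X →L[ℝ] X) (hCsa : IsSelfAdjoint C) (hpos : ∀ y, 0 ≤ ⟪C y, y⟫)
    (u : X) (hu : ‖u‖ = 1) (c : NNReal) (hc : c ≠ 0) (hCu : C u = (c : ℝ) • u)
    (NC : Measure X) [IsProbabilityMeasure NC]
    (hNC : ∀ y : X, Measure.map (fun x => ⟪y, x⟫) NC
      = gaussianReal 0 (Real.toNNReal ⟪C y, y⟫))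
    (F : X → ℂ) (F' : X → X →L[ℝ] ℂ) (hF : ∀ x, HasFDerivAt F (F' x) x)
    (hi : Integrable F NC)
    (hi' : Integrable (fun x => (c : ℂ) * F' x u - (⟪u, x⟫ : ℝ) * F x) NC) :
    ∫ x, ((c : ℂ) * F' x u - (⟪u, x⟫ : ℝ) * F x) ∂NC = 0 := by
  have hm : Measurable (fun p : X × ℝ => (p.1 - ⟪u, p.1⟫ • u) + p.2 • u) := by fun_prop
  have hre := stein_resample C hCsa hpos u hu c hCu NC hNC
  set H : X → ℂ := fun x => (c : ℂ) * F' x u - (⟪u, x⟫ : ℝ) * F x with hH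
  have hi2 := hi
  have hi2' := hi'
  rw [← hre, integrable_map_measure (by rw [hre]; exact hi.1) hm.aemeasurable] at hi2
  rw [← hre, integrable_map_measure (by rw [hre]; exact hi'.1) hm.aemeasurable] at hi2'
  rw [← hre, integral_map hm.aemeasurable (by rw [hre]; exact hi'.1)]
  change ∫ z, (H ∘ fun p : X × ℝ => (p.1 - ⟪u, p.1⟫ • u) + p.2 • u) z ∂_ = 0
  rw [integral_prod _ hi2']
  rw [← integral_zero X ℂ (μ := NC)]
  apply integral_congr_ae
  filter_upwards [hi2.prod_right_ae, hi2'.prod_right_ae] with w h1 h2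
  have hco : ∀ t : ℝ, ⟪u, (w - ⟪u, w⟫ • u) + t • u⟫ = t := by
    intro t
    simp [inner_add_right, inner_sub_right, inner_smul_right, hu]
  have := stein_gauss_one_dim hc (g := fun t : ℝ => F ((w - ⟪u, w⟫ • u) + t • u))
    (g' := fun t : ℝ => F' ((w - ⟪u, w⟫ • u) + t • u) u) ?_ h1 ?_
  · simpa only [hH, Function.comp_apply, hco] using this
  · intro t
    have h3 : HasDerivAt (fun t : ℝ => (w - ⟪u, w⟫ • u) + t • u) u t := by
      simpa using ((hasDerivAt_id t).smul_const u).const_add (w - ⟪u, w⟫ • u)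
    exact (hF _).comp_hasDerivAt t h3
  · simpa only [hH, hco, Function.comp_def] using h2

lemma stein_hasFDerivAt_exp {X : Type*} [NormedAddCommGroup X] [InnerProductSpace ℝ X]
    (s x : X) : HasFDerivAt (fun y : X => Complex.exp (((⟪s, y⟫ : ℝ) : ℂ) * Complex.I))
      ((Complex.exp (((⟪s, x⟫ : ℝ) : ℂ) * Complex.I) * Complex.I) •
        (Complex.ofRealCLM.comp (innerSL ℝ s))) x := by
  have h1 : HasFDerivAt (fun y : X => ((⟪s, y⟫ : ℝ) : ℂ)) (Complex.ofRealCLM.comp (innerSL ℝ s)) x :=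
    (Complex.ofRealCLM.comp (innerSL ℝ s)).hasFDerivAt
  have := (h1.mul_const Complex.I).cexp
  refine this.congr_fderiv ?_
  ext v
  simp
  ring

lemma stein_fderiv_exp {X : Type*} [NormedAddCommGroup X] [InnerProductSpace ℝ X]
    (s x v : X) : fderiv ℝ (fun y : X => Complex.exp (((⟪s, y⟫ : ℝ) : ℂ) * Complex.I)) x v =
      Complex.exp (((⟪s, x⟫ : ℝ) : ℂ) * Complex.I) * Complex.I * (⟪s, v⟫ : ℝ) := by
  rw [(stein_hasFDerivAt_exp s x).fderiv]
  simp

lemma stein_fderiv2_exp {X : Type*} [NormedAddCommGroup X] [InnerProductSpace ℝ X]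
    (s x v : X) : fderiv ℝ (fun x1 =>
      fderiv ℝ (fun y : X => Complex.exp (((⟪s, y⟫ : ℝ) : ℂ) * Complex.I)) x1 v) x v =
      - Complex.exp (((⟪s, x⟫ : ℝ) : ℂ) * Complex.I) * ((⟪s, v⟫ ^ 2 : ℝ) : ℂ) := by
  simp_rw [stein_fderiv_exp s _ v, mul_assoc]
  rw [((stein_hasFDerivAt_exp s x).mul_const _).fderiv]
  simp
  ring_nf
  simp

lemma stein_gammaRe_exp {X : Type*} [NormedAddCommGroup X] [InnerProductSpace ℝ X]
    [CompleteSpace X] (C : X →L[ℝ] X) (DU : X → X) (s x : X) :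
    steinGammaRe C DU (fun y => Complex.exp (((⟪s, y⟫ : ℝ) : ℂ) * Complex.I)) x =
      (Complex.exp (((⟪s, x⟫ : ℝ) : ℂ) * Complex.I) * Complex.I).re • C s
      - (Complex.exp (((⟪s, x⟫ : ℝ) : ℂ) * Complex.I)).re • (x + C (DU x)) := by
  unfold steinGammaRe
  rw [← map_smul]
  congr 2
  rw [LinearIsometryEquiv.symm_apply_eq]
  ext v
  simp only [ContinuousLinearMap.comp_apply, stein_fderiv_exp, InnerProductSpace.toDual_apply_apply,
    inner_smul_left, conj_trivial, Complex.reCLM_apply, Complex.re_mul_ofReal]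

lemma stein_gammaIm_exp {X : Type*} [NormedAddCommGroup X] [InnerProductSpace ℝ X]
    [CompleteSpace X] (C : X →L[ℝ] X) (DU : X → X) (s x : X) :
    steinGammaIm C DU (fun y => Complex.exp (((⟪s, y⟫ : ℝ) : ℂ) * Complex.I)) x =
      (Complex.exp (((⟪s, x⟫ : ℝ) : ℂ) * Complex.I) * Complex.I).im • C s
      - (Complex.exp (((⟪s, x⟫ : ℝ) : ℂ) * Complex.I)).im • (x + C (DU x)) := by
  unfold steinGammaIm
  rw [← map_smul]
  congr 2
  rw [LinearIsometryEquiv.symm_apply_eq]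
  ext v
  simp only [ContinuousLinearMap.comp_apply, stein_fderiv_exp, InnerProductSpace.toDual_apply_apply,
    inner_smul_left, conj_trivial, Complex.imCLM_apply, Complex.im_mul_ofReal]

lemma stein_A_exp {X : Type*} [NormedAddCommGroup X] [InnerProductSpace ℝ X]
    [CompleteSpace X] (C : X →L[ℝ] X) (hCsa : IsSelfAdjoint C)
    (e : HilbertBasis ℕ ℝ X) (l : ℕ → ℝ)
    (hCe : ∀ i, C (e i) = l i • e i) (DU : X → X) (s x : X) :
    steinA C DU (fun i => e i) l (fun y => Complex.exp (((⟪s, y⟫ : ℝ) : ℂ) * Complex.I)) x =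
      Complex.I *
        ((⟪s, steinGammaRe C DU (fun y => Complex.exp (((⟪s, y⟫ : ℝ) : ℂ) * Complex.I)) x⟫ : ℝ) +
        (⟪s, steinGammaIm C DU (fun y => Complex.exp (((⟪s, y⟫ : ℝ) : ℂ) * Complex.I)) x⟫ : ℝ)
          * Complex.I) := by
  rw [stein_gammaRe_exp, stein_gammaIm_exp]
  unfold steinA
  simp only [stein_fderiv2_exp]
  rw [stein_fderiv_exp]
  set z := Complex.exp (((⟪s, x⟫ : ℝ) : ℂ) * Complex.I)
  have hsum := stein_quad_nonneg C hCsa e l hCe s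
  have h1 : HasSum (fun i => (l i : ℂ) * (-z * ((⟪s, e i⟫ ^ 2 : ℝ) : ℂ)))
      (-z * (⟪C s, s⟫ : ℝ)) := by
    have := (Complex.hasSum_ofReal.2 hsum).mul_left (-z)
    suffices hfun : (fun i => (l i : ℂ) * (-z * ((⟪s, e i⟫ ^ 2 : ℝ) : ℂ))) =
        fun i => -z * ((l i * ⟪s, e i⟫ ^ 2 : ℝ) : ℂ) by
      rw [hfun]; exact this
    funext i
    push_cast
    ring
  rw [h1.tsum_eq]
  have h2 := Complex.re_add_im z
  simp only [inner_sub_right, inner_smul_right, real_inner_comm s (C s)]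
  have h3 := Complex.re_add_im (z * Complex.I)
  generalize ⟪s, x + C (DU x)⟫ = b
  generalize ⟪s, C s⟫ = a
  push_cast
  linear_combination (-(a * Complex.I)) * h3 + (Complex.I * b) * h2 - a * z * Complex.I_sq

/-- **Stein identity for Gibbs measures on exponential test functions** (proved within
Theorem 3): for every `s ∈ X`, `∫ Γ(e^{i⟪s,·⟫}) dP = 0` in `X_ℂ` (both real and
imaginary parts vanish) and consequently `∫ A(e^{i⟪s,·⟫}) dP = 0`. -/
theorem gibbs_stein_identity_exponentials
    {X : Type*} [NormedAddCommGroup X] [InnerProductSpace ℝ X] [CompleteSpace X]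
    [MeasurableSpace X] [BorelSpace X] [SecondCountableTopology X]
    -- the covariance operator and its eigendecomposition
    (C : X →L[ℝ] X) (hCsa : IsSelfAdjoint C)
    (e : HilbertBasis ℕ ℝ X) (l : ℕ → ℝ) (hl : ∀ i, 0 < l i)
    (hCe : ∀ i, C (e i) = l i • e i) (hltr : Summable l)
    -- the potential `U` and its gradient `DU`
    (U : X → ℝ) (DU : X → X)
    (hU : ∀ x, HasFDerivAt U ((InnerProductSpace.toDual ℝ X) (DU x) : X →L[ℝ] ℝ) x)
    -- the Gaussian reference measure `N_C`
    (NC : Measure X) [IsProbabilityMeasure NC]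
    (hNC : ∀ y : X, Measure.map (fun x => ⟪y, x⟫) NC
      = gaussianReal 0 (Real.toNNReal ⟪C y, y⟫))
    -- the Gibbs target measure `P ∝ e^{-U} N_C`
    (hexpU : Integrable (fun x => Real.exp (-U x)) NC)
    (hZpos : 0 < ∫ x, Real.exp (-U x) ∂NC)
    (P : Measure X) [IsProbabilityMeasure P]
    (hP : P = (ENNReal.ofReal (∫ x, Real.exp (-U x) ∂NC))⁻¹ •
        NC.withDensity (fun x => ENNReal.ofReal (Real.exp (-U x))))
    -- the square root `C^{1/2}` of `C` and the Malliavin-type integrability conditions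
    (Csqrt : X →L[ℝ] X) (hCsqrt : ∀ i, Csqrt (e i) = Real.sqrt (l i) • e i)
    (hDU1 : Integrable (fun x => ‖Csqrt (DU x)‖ ^ 2) NC)
    (hDU2 : Integrable (fun x => Real.exp (-U x) * ‖Csqrt (DU x)‖ ^ 2) NC)
    -- the additional moment condition on `P`
    (hPmom : Integrable (fun x => ‖x‖ + ‖C (DU x)‖) P) :
    ∀ s : X,
      (∫ x, steinGammaRe C DU (fun y => Complex.exp ((⟪s, y⟫ : ℂ) * Complex.I)) x ∂P = 0) ∧
      (∫ x, steinGammaIm C DU (fun y => Complex.exp ((⟪s, y⟫ : ℂ) * Complex.I)) x ∂P = 0) ∧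
      ∫ x, steinA C DU (fun i => e i) l
          (fun y => Complex.exp ((⟪s, y⟫ : ℂ) * Complex.I)) x ∂P = 0 := by
  intro s
  set f : X → ℂ := fun y => Complex.exp ((⟪s, y⟫ : ℂ) * Complex.I) with hf
  have hpos : ∀ y, 0 ≤ ⟪C y, y⟫ := fun y =>
    (stein_quad_nonneg C hCsa e l hCe y).nonneg fun i => mul_nonneg (hl i).le (sq_nonneg _)
  have hUc : Continuous U := continuous_iff_continuousAt.2 fun x => (hU x).continuousAt
  have hfc : Continuous f := by fun_prop
  have hfn : ∀ x, ‖f x‖ = 1 := fun x => Complex.norm_exp_ofReal_mul_I _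
  have hCsym : ∀ a b : X, ⟪C a, b⟫ = ⟪a, C b⟫ := by
    intro a b
    rw [← ContinuousLinearMap.adjoint_inner_right, hCsa.adjoint_eq]
  have hDUm : Measurable DU := by
    have h1 : DU = fun x => (InnerProductSpace.toDual ℝ X).symm (fderiv ℝ U x) := by
      funext x
      rw [(hU x).fderiv]
      simp
    rw [h1]
    exact (InnerProductSpace.toDual ℝ X).symm.continuous.measurable.comp (measurable_fderiv ℝ U)
  have hb : Measurable (fun x => x + C (DU x)) := by fun_prop
  -- the density
  have hZ : (ENNReal.ofReal (∫ x, Real.exp (-U x) ∂NC))⁻¹ ≠ ⊤ := by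
    simp [hZpos]
  have hZ0 : (ENNReal.ofReal (∫ x, Real.exp (-U x) ∂NC))⁻¹ ≠ 0 := by
    simp
  have hdm : Measurable (fun x => ENNReal.ofReal (Real.exp (-U x))) := by fun_prop
  have hPi : ∀ G : X → ℂ, Integrable G P → Integrable (fun x => Real.exp (-U x) • G x) NC := by
    intro G hG
    rw [hP, integrable_smul_measure hZ0 hZ, integrable_withDensity_iff_integrable_smul' hdm
      (ae_of_all _ fun _ => ENNReal.ofReal_lt_top)] at hG
    simpa only [ENNReal.toReal_ofReal (Real.exp_pos _).le] using hG
  have hPint : ∀ G : X → ℂ, ∫ x, Real.exp (-U x) • G x ∂NC = 0 → ∫ x, G x ∂P = 0 := by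
    intro G hG
    rw [hP, integral_smul_measure, integral_withDensity_eq_integral_toReal_smul hdm
      (ae_of_all _ fun _ => ENNReal.ofReal_lt_top)]
    simp only [ENNReal.toReal_ofReal (Real.exp_pos _).le, hG, smul_zero]
  have hdom : Integrable (fun x => ‖C s‖ + (‖x‖ + ‖C (DU x)‖)) P := (integrable_const _).add hPmom
  have hre1 : ∀ z : ℂ, ‖z‖ = 1 → |z.re| ≤ 1 := fun z hz => hz ▸ Complex.abs_re_le_norm z
  have him1 : ∀ z : ℂ, ‖z‖ = 1 → |z.im| ≤ 1 := fun z hz => hz ▸ Complex.abs_im_le_norm z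
  have hfIn : ∀ x, ‖f x * Complex.I‖ = 1 := fun x => by simp [hfn]
  have hbound : ∀ (a b : ℝ) (x : X), |a| ≤ 1 → |b| ≤ 1 →
      ‖a • C s - b • (x + C (DU x))‖ ≤ ‖C s‖ + (‖x‖ + ‖C (DU x)‖) := by
    intro a b x ha hb
    refine (norm_sub_le _ _).trans ?_
    rw [norm_smul, norm_smul, Real.norm_eq_abs, Real.norm_eq_abs]
    exact add_le_add (mul_le_of_le_one_left (norm_nonneg _) ha)
      ((mul_le_of_le_one_left (norm_nonneg _) hb).trans (norm_add_le _ _))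
  have hReq : ∀ x, steinGammaRe C DU f x =
      (f x * Complex.I).re • C s - (f x).re • (x + C (DU x)) := stein_gammaRe_exp C DU s
  have hImq : ∀ x, steinGammaIm C DU f x =
      (f x * Complex.I).im • C s - (f x).im • (x + C (DU x)) := stein_gammaIm_exp C DU s
  have hfm : Measurable f := hfc.measurable
  have hReI : Integrable (steinGammaRe C DU f) P := by
    refine hdom.mono' ?_ (ae_of_all _ fun x => ?_)
    · rw [funext hReq]
      have h1 : Measurable fun x => (f x * Complex.I).re :=
        Complex.measurable_re.comp (hfm.mul_const _)
      have h2 : Measurable fun x => (f x).re := Complex.measurable_re.comp hfm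
      exact ((h1.smul_const _).sub (h2.smul hb)).aestronglyMeasurable
    · rw [hReq]
      exact hbound _ _ _ (hre1 _ (hfIn x)) (hre1 _ (hfn x))
  have hImI : Integrable (steinGammaIm C DU f) P := by
    refine hdom.mono' ?_ (ae_of_all _ fun x => ?_)
    · rw [funext hImq]
      have h1 : Measurable fun x => (f x * Complex.I).im :=
        Complex.measurable_im.comp (hfm.mul_const _)
      have h2 : Measurable fun x => (f x).im := Complex.measurable_im.comp hfm
      exact ((h1.smul_const _).sub (h2.smul hb)).aestronglyMeasurable
    · rw [hImq]
      exact hbound _ _ _ (him1 _ (hfIn x)) (him1 _ (hfn x))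
  -- the coordinatewise complex identity
  set K : ℕ → X → ℂ := fun i x =>
    f x * Complex.I * (⟪e i, C s⟫ : ℝ) - f x * (⟪e i, x + C (DU x)⟫ : ℝ) with hK
  have hKre : ∀ i x, ⟪e i, steinGammaRe C DU f x⟫ = (K i x).re := by
    intro i x
    rw [hReq, inner_sub_right, inner_smul_right, inner_smul_right, hK]
    simp only [Complex.sub_re, Complex.re_mul_ofReal]
  have hKim : ∀ i x, ⟪e i, steinGammaIm C DU f x⟫ = (K i x).im := by
    intro i x
    rw [hImq, inner_sub_right, inner_smul_right, inner_smul_right, hK]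
    simp only [Complex.sub_im, Complex.im_mul_ofReal]
  have hKI : ∀ i, Integrable (K i) P := by
    intro i
    have h1 : Integrable (fun x => ((⟪e i, steinGammaRe C DU f x⟫ : ℝ) : ℂ)) P :=
      (hReI.const_inner (e i)).ofReal
    have h2 : Integrable (fun x => ((⟪e i, steinGammaIm C DU f x⟫ : ℝ) : ℂ)) P :=
      (hImI.const_inner (e i)).ofReal
    refine (h1.add (h2.mul_const Complex.I)).congr (ae_of_all _ fun x => ?_)
    simp only [Pi.add_apply, hKre, hKim, Complex.re_add_im]
  have hK0 : ∀ i, ∫ x, K i x ∂P = 0 := by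
    intro i
    apply hPint
    have hli : ((⟨l i, (hl i).le⟩ : NNReal) : ℝ) = l i := rfl
    have hd : ∀ x, HasFDerivAt (fun x => f x * ((Real.exp (-U x) : ℝ) : ℂ)) _ x := fun x =>
      (stein_hasFDerivAt_exp s x).mul
        (Complex.ofRealCLM.hasFDerivAt.comp x ((hU x).neg.exp))
    have heq : ∀ x, ((⟨l i, (hl i).le⟩ : NNReal) : ℂ) * (f x • Complex.ofRealCLM.comp
        (Real.exp (-U x) • -((InnerProductSpace.toDual ℝ X) (DU x) : X →L[ℝ] ℝ)) +
        ((Real.exp (-U x) : ℝ) : ℂ) • ((f x * Complex.I) •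
        (Complex.ofRealCLM.comp (innerSL ℝ s)))) (e i) -
        (⟪e i, x⟫ : ℝ) * (f x * ((Real.exp (-U x) : ℝ) : ℂ)) = Real.exp (-U x) • K i x := by
      intro x
      have h1 : ⟪e i, C s⟫ = l i * ⟪s, e i⟫ := by
        rw [← hCsym, hCe, inner_smul_left, real_inner_comm]; rfl
      have h2 : ⟪e i, C (DU x)⟫ = l i * ⟪DU x, e i⟫ := by
        rw [← hCsym, hCe, inner_smul_left, real_inner_comm]; rfl
      simp only [hK, h1, inner_add_right, h2, Complex.real_smul, hli]
      simp
      ring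
    have := stein_core C hCsa hpos (e i) (e.orthonormal.1 i) ⟨l i, (hl i).le⟩
      (fun h => (hl i).ne' (congrArg NNReal.toReal h)) (hCe i) NC hNC _ _ hd ?_ ?_
    · rw [← this]
      exact integral_congr_ae (ae_of_all _ fun x => (heq x).symm)
    · refine hexpU.mono' (by fun_prop) (ae_of_all _ fun x => ?_)
      rw [norm_mul, hfn, one_mul, Complex.norm_real, Real.norm_eq_abs, abs_of_pos (Real.exp_pos _)]
    · exact (hPi _ (hKI i)).congr (ae_of_all _ fun x => (heq x).symm)
  have hzero : ∀ v : X, (∀ i, ⟪e i, v⟫ = 0) → v = 0 := by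
    intro v hv
    have := e.hasSum_inner_mul_inner v v
    simp only [hv, mul_zero] at this
    exact inner_self_eq_zero.1 (this.unique hasSum_zero)
  have hA : ∫ x, steinGammaRe C DU f x ∂P = 0 := by
    apply hzero
    intro i
    rw [← integral_inner hReI]
    simp only [hKre]
    have := integral_re (hKI i)
    simp only [hK0 i] at this
    simpa using this
  have hB : ∫ x, steinGammaIm C DU f x ∂P = 0 := by
    apply hzero
    intro i
    rw [← integral_inner hImI]
    simp only [hKim]
    have := integral_im (hKI i)
    simp only [hK0 i] at this
    simpa using this
  refine ⟨hA, hB, ?_⟩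
  have h1 : ∀ x, steinA C DU (fun i => e i) l f x = Complex.I *
      ((⟪s, steinGammaRe C DU f x⟫ : ℝ) + (⟪s, steinGammaIm C DU f x⟫ : ℝ) * Complex.I) :=
    stein_A_exp C hCsa e l hCe DU s
  simp only [h1]
  have h2 : Integrable (fun x => ((⟪s, steinGammaRe C DU f x⟫ : ℝ) : ℂ)) P :=
    (hReI.const_inner s).ofReal
  have h3 : Integrable (fun x => ((⟪s, steinGammaIm C DU f x⟫ : ℝ) : ℂ)) P :=
    (hImI.const_inner s).ofReal
  rw [integral_const_mul, integral_add h2 (h3.mul_const _), integral_mul_const,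
    integral_complex_ofReal, integral_complex_ofReal, integral_inner hReI, integral_inner hImI,
    hA, hB]
  simp
end
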